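/- arXiv:1705.08820 — 5 statements merged into one kernel-verified Lean document; each statement's English description precedes it below -/
import Mathlib

section
/- Fix N ≥ 1, a nonzero γ ∈ ℤ², elements α₁, …, α_N ∈ ℤ², and scalars c_{ji} ∈ ℂ for 1 ≤ i, j ≤ N such that c_{ji} = 0 whenever α_j − α_i is not a nonzero integer multiple of γ. For Z = (z₁, z₂) ∈ ℂ² and α = (a₁, a₂) ∈ ℤ² write Z(α) = a₁ z₁ + a₂ z₂. On the open set M = {Z ∈ ℂ² : Z(γ) ≠ 0} define matrix-valued functions A₁, A₂ : M → M_N(ℂ) by (A_p(Z))_{ji} = c_{ji} · (α_j − α_i)_p / Z(α_j − α_i) when c_{ji} ≠ 0, and (A_p(Z))_{ji} = 0 otherwise (the denominator is nonzero on M since α_j − α_i is then a nonzero multiple of γ); let V ∈ M_N(ℂ) be the constant matrix with V_{ji} = c_{ji}. Then at every point of M: (i) ∂A₂/∂z₁ − ∂A₁/∂z₂ + A₁A₂ − A₂A₁ = 0, i.e. the connection d + A₁ dz₁ + A₂ dz₂ on the trivial rank-N bundle over M is flat; and (ii) A_p V − V A_p = 0 for p = 1, 2, i.e. V is covariantly constant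 for this connection. -/
/-- The central charge pairing: `Z(α) = a₁ z₁ + a₂ z₂` for `Z = (z₁, z₂) ∈ ℂ²`
and `α = (a₁, a₂) ∈ ℤ²`. -/
def pairZ (Z : ℂ × ℂ) (a : ℤ × ℤ) : ℂ := (a.1 : ℂ) * Z.1 + (a.2 : ℂ) * Z.2

/-- The first connection matrix `A₁(Z)` with entries
`c_{ji} (α_j - α_i)₁ / Z(α_j - α_i)` when `c_{ji} ≠ 0`, and `0` otherwise. -/
noncomputable def connA₁ {N : ℕ} (α : Fin N → ℤ × ℤ) (c : Fin N → Fin N → ℂ)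
    (Z : ℂ × ℂ) : Matrix (Fin N) (Fin N) ℂ :=
  Matrix.of fun j i =>
    if c j i ≠ 0 then c j i * (((α j - α i).1 : ℂ)) / pairZ Z (α j - α i) else 0

/-- The second connection matrix `A₂(Z)` with entries
`c_{ji} (α_j - α_i)₂ / Z(α_j - α_i)` when `c_{ji} ≠ 0`, and `0` otherwise. -/
noncomputable def connA₂ {N : ℕ} (α : Fin N → ℤ × ℤ) (c : Fin N → Fin N → ℂ)
    (Z : ℂ × ℂ) : Matrix (Fin N) (Fin N) ℂ :=
  Matrix.of fun j i =>
    if c j i ≠ 0 then c j i * (((α j - α i).2 : ℂ)) / pairZ Z (α j - α i) else 0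

theorem pairZ_zsmul (Z : ℂ × ℂ) (m : ℤ) (a : ℤ × ℤ) : pairZ Z (m • a) = m * pairZ Z a := by
  simp only [pairZ, Prod.smul_fst, Prod.smul_snd, smul_eq_mul, Int.cast_mul]
  ring

/-- On coefficients supported on `ℤγ ∖ {0}`, the multiple `m` with `α_j - α_i = mγ` cancels, so
`A₁` is a scalar multiple of the coefficient matrix. -/
theorem connA₁_eq_smul {N : ℕ} {γ : ℤ × ℤ} {α : Fin N → ℤ × ℤ} {c : Fin N → Fin N → ℂ}
    (hc : ∀ j i : Fin N, (¬ ∃ m : ℤ, m ≠ 0 ∧ α j - α i = m • γ) → c j i = 0) (Z : ℂ × ℂ) :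
    connA₁ α c Z = ((γ.1 : ℂ) / pairZ Z γ) • Matrix.of c := by
  ext j i
  by_cases h : c j i = 0
  · simp [connA₁, h]
  · obtain ⟨m, hm, hd⟩ := not_not.mp (mt (hc j i) h)
    have hmc : (m : ℂ) ≠ 0 := Int.cast_ne_zero.mpr hm
    simp only [connA₁, Matrix.of_apply, Matrix.smul_apply, smul_eq_mul, hd, pairZ_zsmul,
      if_pos (show c j i ≠ 0 from h), Prod.smul_fst, Int.cast_mul]
    rw [mul_left_comm, mul_div_mul_left _ _ hmc]
    ring

/-- On coefficients supported on `ℤγ ∖ {0}`, the multiple `m` with `α_j - α_i = mγ` cancels, so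
`A₂` is a scalar multiple of the coefficient matrix. -/
theorem connA₂_eq_smul {N : ℕ} {γ : ℤ × ℤ} {α : Fin N → ℤ × ℤ} {c : Fin N → Fin N → ℂ}
    (hc : ∀ j i : Fin N, (¬ ∃ m : ℤ, m ≠ 0 ∧ α j - α i = m • γ) → c j i = 0) (Z : ℂ × ℂ) :
    connA₂ α c Z = ((γ.2 : ℂ) / pairZ Z γ) • Matrix.of c := by
  ext j i
  by_cases h : c j i = 0
  · simp [connA₂, h]
  · obtain ⟨m, hm, hd⟩ := not_not.mp (mt (hc j i) h)
    have hmc : (m : ℂ) ≠ 0 := Int.cast_ne_zero.mpr hm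
    simp only [connA₂, Matrix.of_apply, Matrix.smul_apply, smul_eq_mul, hd, pairZ_zsmul,
      if_pos (show c j i ≠ 0 from h), Prod.smul_snd, Int.cast_mul]
    rw [mul_left_comm, mul_div_mul_left _ _ hmc]
    ring

theorem hasDerivAt_pairZ_fst (Z : ℂ × ℂ) (a : ℤ × ℤ) :
    HasDerivAt (fun w : ℂ => pairZ (w, Z.2) a) (a.1 : ℂ) Z.1 := by
  simpa [pairZ] using
    ((hasDerivAt_id Z.1).const_mul (a.1 : ℂ)).add_const ((a.2 : ℂ) * Z.2)

theorem hasDerivAt_pairZ_snd (Z : ℂ × ℂ) (a : ℤ × ℤ) :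
    HasDerivAt (fun w : ℂ => pairZ (Z.1, w) a) (a.2 : ℂ) Z.2 := by
  simpa [pairZ] using
    ((hasDerivAt_id Z.2).const_mul (a.2 : ℂ)).const_add ((a.1 : ℂ) * Z.1)

/-- For coefficients `c_{ji}` supported on differences `α_j - α_i` lying in `ℤγ ∖ {0}`,
the connection `d + A₁ dz₁ + A₂ dz₂` on `M = {Z : Z(γ) ≠ 0}` is flat and the constant
matrix `V = (c_{ji})` is covariantly constant for it. -/
theorem uncoupled_projection_flat (N : ℕ) (hN : 1 ≤ N) (γ : ℤ × ℤ) (hγ : γ ≠ 0)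
    (α : Fin N → ℤ × ℤ) (c : Fin N → Fin N → ℂ)
    (hc : ∀ j i : Fin N, (¬ ∃ m : ℤ, m ≠ 0 ∧ α j - α i = m • γ) → c j i = 0) :
    ∀ Z : ℂ × ℂ, pairZ Z γ ≠ 0 →
      -- (i) flatness: ∂A₂/∂z₁ − ∂A₁/∂z₂ + A₁A₂ − A₂A₁ = 0
      (∃ dA₂dz₁ dA₁dz₂ : Matrix (Fin N) (Fin N) ℂ,
        (∀ j i : Fin N,
          HasDerivAt (fun w : ℂ => connA₂ α c (w, Z.2) j i) (dA₂dz₁ j i) Z.1) ∧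
        (∀ j i : Fin N,
          HasDerivAt (fun w : ℂ => connA₁ α c (Z.1, w) j i) (dA₁dz₂ j i) Z.2) ∧
        dA₂dz₁ - dA₁dz₂ + connA₁ α c Z * connA₂ α c Z - connA₂ α c Z * connA₁ α c Z = 0) ∧
      -- (ii) V is covariantly constant: [A_p, V] = 0 for p = 1, 2
      connA₁ α c Z * Matrix.of c - Matrix.of c * connA₁ α c Z = 0 ∧
      connA₂ α c Z * Matrix.of c - Matrix.of c * connA₂ α c Z = 0 := by
  intro Z hZ
  refine ⟨⟨(-((γ.1 : ℂ) * γ.2) / pairZ Z γ ^ 2) • Matrix.of c,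
    (-((γ.1 : ℂ) * γ.2) / pairZ Z γ ^ 2) • Matrix.of c, fun j i => ?_, fun j i => ?_, ?_⟩, ?_, ?_⟩
  · simp only [connA₂_eq_smul hc, Matrix.smul_apply, smul_eq_mul]
    refine HasDerivAt.mul_const ?_ _
    convert (hasDerivAt_const Z.1 (γ.2 : ℂ)).fun_div (hasDerivAt_pairZ_fst Z γ) hZ using 1
    ring
  · simp only [connA₁_eq_smul hc, Matrix.smul_apply, smul_eq_mul]
    refine HasDerivAt.mul_const ?_ _
    convert (hasDerivAt_const Z.2 (γ.1 : ℂ)).fun_div (hasDerivAt_pairZ_snd Z γ) hZ using 1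
    ring
  · rw [connA₁_eq_smul hc, connA₂_eq_smul hc, sub_self, zero_add, sub_eq_zero]
    exact (((Commute.refl (Matrix.of c)).smul_left _).smul_right _).eq
  · rw [connA₁_eq_smul hc, sub_eq_zero]
    exact ((Commute.refl (Matrix.of c)).smul_left _).eq
  · rw [connA₂_eq_smul hc, sub_eq_zero]
    exact ((Commute.refl (Matrix.of c)).smul_left _).eq
end

section
/- Let z₁, z₂, ν ∈ ℂ and let V ⊆ ℂ ∖ {0} be open. Suppose w₁, w₂ : V → ℂ are holomorphic and satisfy w₁′(t) = (−z₁/t²) w₁(t) + (ν/t) w₂(t) and w₂′(t) = (−ν/t) w₁(t) + (−z₂/t²) w₂(t) for all t ∈ V (i.e. (w₁, w₂) solves the linear system ∂_t Y = (−t^{−2} U + t^{−1} V) Y with U = diag(z₁, z₂) and V the off-diagonal matrix with entries V₁₂ = ν, V₂₁ = −ν). Let W = {z ∈ ℂ ∖ {0} : 1/z ∈ V} and define u(z) = w₁(1/z). Then u is twice differentiable on W and satisfies the confluent hypergeometric differential equation u″(z) + (1/z − z₁ − z₂) u′(z) + (ν²/z² − z₁/z + z₁ z₂) u(z) = 0 for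 all z ∈ W. -/
/-- Chain rule for the inversion `z ↦ 1 / z`. -/
theorem HasDerivAt.comp_one_div {w : ℂ → ℂ} {w' z : ℂ} (hz : z ≠ 0)
    (hw : HasDerivAt w w' (1 / z)) :
    HasDerivAt (fun x : ℂ => w (1 / x)) (w' * -(z ^ 2)⁻¹) z := by
  simp only [one_div] at hw ⊢
  exact hw.comp z (hasDerivAt_inv hz)


/-- If `(w₁, w₂)` solves the linear system `∂_t Y = (−t⁻²U + t⁻¹V)Y` with
`U = diag(z₁, z₂)` and `V` the off-diagonal matrix with `V₁₂ = ν`, `V₂₁ = −ν`, on an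
open set `V ⊆ ℂ ∖ {0}`, then `u(z) = w₁(1/z)` satisfies the confluent hypergeometric
equation `u″ + (1/z − z₁ − z₂)u′ + (ν²/z² − z₁/z + z₁z₂)u = 0` on
`W = {z ≠ 0 : 1/z ∈ V}`. -/
theorem oscillator_to_confluent_hypergeometric
    (z₁ z₂ ν : ℂ) (V : Set ℂ) (hV : IsOpen V) (hV0 : (0 : ℂ) ∉ V)
    (w₁ w₂ : ℂ → ℂ)
    (h₁ : ∀ t ∈ V, HasDerivAt w₁ (-z₁ / t ^ 2 * w₁ t + ν / t * w₂ t) t)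
    (h₂ : ∀ t ∈ V, HasDerivAt w₂ (-ν / t * w₁ t + -z₂ / t ^ 2 * w₂ t) t) :
    ∀ z : ℂ, z ≠ 0 → 1 / z ∈ V →
      DifferentiableAt ℂ (deriv (fun z' : ℂ => w₁ (1 / z'))) z ∧
      deriv (deriv (fun z' : ℂ => w₁ (1 / z'))) z
        + (1 / z - z₁ - z₂) * deriv (fun z' : ℂ => w₁ (1 / z')) z
        + (ν ^ 2 / z ^ 2 - z₁ / z + z₁ * z₂) * w₁ (1 / z) = 0 := by
  have hA : ∀ z : ℂ, z ≠ 0 → 1 / z ∈ V → HasDerivAt (fun x : ℂ => w₁ (1 / x))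
      (z₁ * w₁ (1 / z) - ν * (w₂ (1 / z) / z)) z := by
    intro z hz hzV
    refine ((h₁ _ hzV).comp_one_div hz).congr_deriv ?_
    field_simp
    ring
  have hB : ∀ z : ℂ, z ≠ 0 → 1 / z ∈ V → HasDerivAt (fun x : ℂ => w₂ (1 / x))
      (ν * w₁ (1 / z) / z + z₂ * w₂ (1 / z)) z := by
    intro z hz hzV
    refine ((h₂ _ hzV).comp_one_div hz).congr_deriv ?_
    field_simp
    ring
  intro z hz hzV
  have hcont : ContinuousAt (fun x : ℂ => 1 / x) z :=
    continuousAt_const.div continuousAt_id hz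
  have hderiv : deriv (fun x : ℂ => w₁ (1 / x)) =ᶠ[nhds z]
      fun x => z₁ * w₁ (1 / x) - ν * (w₂ (1 / x) / x) := by
    filter_upwards [isOpen_ne.mem_nhds hz, hcont.preimage_mem_nhds (hV.mem_nhds hzV)]
      with x hx hxV
    exact (hA x hx hxV).deriv
  have hsecond := ((((hA z hz hzV).const_mul z₁).sub
    (((hB z hz hzV).div (hasDerivAt_id z) hz).const_mul ν)).congr_of_eventuallyEq hderiv)
  refine ⟨hsecond.differentiableAt, ?_⟩
  rw [hsecond.deriv, (hA z hz hzV).deriv]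
  simp only [id]
  field_simp
  ring
end

section
/- Let c ∈ ℂ with c ≠ 0, and let a ∈ ℂ satisfy a² = −c². Define c₀ = 1 and c_n = (∏_{k=0}^{n−1} (k² − a²)) / (n!)² for n ≥ 1, let u(z) = ∑_{n=0}^∞ c_n z^n on the unit disc, and set v(z) = (z/c) u′(z). Then u and v are holomorphic on the open unit disc, u(0) = 1, v(0) = 0, and for all z with 0 < |z| < 1 one has u′(z) = (c/z) v(z) and v′(z) = −(c/(z−1)) u(z). -/
/-- The coefficients of the Gauss hypergeometric series `₂F₁(−a, a, 1; z)`: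
`c₀ = 1` and `c_n = (∏_{k=0}^{n−1} (k² − a²)) / (n!)²` for `n ≥ 1`. -/
noncomputable def hgCoeff (a : ℂ) (n : ℕ) : ℂ :=
  (∏ k ∈ Finset.range n, ((k : ℂ) ^ 2 - a ^ 2)) / ((Nat.factorial n : ℂ)) ^ 2

/-- The hypergeometric sum `u(z) = ∑_{n≥0} c_n zⁿ`. -/
noncomputable def hgSum (a : ℂ) (z : ℂ) : ℂ := ∑' n : ℕ, hgCoeff a n * z ^ n

open Filter

theorem hasSum_deriv_powerSeries {b : ℕ → ℂ}
    (hb : ∀ z : ℂ, ‖z‖ < 1 → Summable fun n => b n * z ^ n) {z : ℂ} (hz : ‖z‖ < 1) :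
    DifferentiableAt ℂ (fun w => ∑' n, b n * w ^ n) z ∧
      HasSum (fun n : ℕ => b n * (n * z ^ (n - 1))) (deriv (fun w => ∑' n, b n * w ^ n) z) := by
  obtain ⟨r, hzr, hr⟩ := exists_between hz
  have hr0 : 0 ≤ r := (norm_nonneg z).trans hzr.le
  have hsum : Summable fun n => ‖b n * (r : ℂ) ^ n‖ :=
    (hb r (by simpa [abs_of_nonneg hr0] using hr)).norm
  have hdiff : ∀ n : ℕ, DifferentiableOn ℂ (fun w => b n * w ^ n) (Metric.ball 0 r) :=
    fun n => by fun_prop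
  have hle : ∀ (n : ℕ) (w : ℂ), w ∈ Metric.ball (0 : ℂ) r →
      ‖b n * w ^ n‖ ≤ ‖b n * (r : ℂ) ^ n‖ := by
    intro n w hw
    rw [mem_ball_zero_iff] at hw
    simp only [norm_mul, norm_pow, Complex.norm_real, Real.norm_of_nonneg hr0]
    gcongr
  have hmem : z ∈ Metric.ball (0 : ℂ) r := by simpa using hzr
  refine ⟨(Complex.differentiableOn_tsum_of_summable_norm hsum hdiff Metric.isOpen_ball
    hle).differentiableAt (Metric.isOpen_ball.mem_nhds hmem), ?_⟩
  simpa using Complex.hasSum_deriv_of_summable_norm hsum hdiff Metric.isOpen_ball hle hmem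

theorem hasSum_mul_deriv_powerSeries {b : ℕ → ℂ}
    (hb : ∀ z : ℂ, ‖z‖ < 1 → Summable fun n => b n * z ^ n) {z : ℂ} (hz : ‖z‖ < 1) :
    HasSum (fun n : ℕ => (n * b n) * z ^ n) (z * deriv (fun w => ∑' n, b n * w ^ n) z) := by
  refine ((hasSum_deriv_powerSeries hb hz).2.mul_left z).congr_fun fun n => ?_
  rcases n with _ | n
  · simp
  · simp only [Nat.add_sub_cancel]
    ring

theorem hasSum_succ_deriv_powerSeries {b : ℕ → ℂ}
    (hb : ∀ z : ℂ, ‖z‖ < 1 → Summable fun n => b n * z ^ n) {z : ℂ} (hz : ‖z‖ < 1) :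
    HasSum (fun n : ℕ => ((n + 1) * b (n + 1)) * z ^ n)
      (deriv (fun w => ∑' n, b n * w ^ n) z) := by
  have h := (hasSum_nat_add_iff' 1).2 (hasSum_deriv_powerSeries hb hz).2
  simp only [Finset.range_one, Finset.sum_singleton, Nat.cast_zero, zero_mul, mul_zero, sub_zero,
    Nat.add_sub_cancel, Nat.cast_add, Nat.cast_one] at h
  refine h.congr_fun fun n => ?_
  ring

theorem hgCoeff_zero (a : ℂ) : hgCoeff a 0 = 1 := by
  simp [hgCoeff]

theorem succ_sq_mul_hgCoeff_succ (a : ℂ) (n : ℕ) :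
    ((n : ℂ) + 1) ^ 2 * hgCoeff a (n + 1) = ((n : ℂ) ^ 2 - a ^ 2) * hgCoeff a n := by
  have h1 : (n : ℂ) + 1 ≠ 0 := Nat.cast_add_one_ne_zero n
  have h2 : (n.factorial : ℂ) ≠ 0 := Nat.cast_ne_zero.2 n.factorial_ne_zero
  simp only [hgCoeff, Finset.prod_range_succ, Nat.factorial_succ, Nat.cast_mul, Nat.cast_add,
    Nat.cast_one]
  field_simp

theorem summable_hgCoeff_mul_pow (a : ℂ) {z : ℂ} (hz : ‖z‖ < 1) :
    Summable fun n => hgCoeff a n * z ^ n := by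
  obtain ⟨r, hzr, hr⟩ := exists_between hz
  obtain ⟨N, hN⟩ := exists_nat_ge (‖a‖ ^ 2 * ‖z‖ / (r - ‖z‖))
  refine summable_of_ratio_norm_eventually_le hr (eventually_atTop.2 ⟨N, fun n hn => ?_⟩)
  have hrec := congrArg norm (succ_sq_mul_hgCoeff_succ a n)
  have hn1 : ‖(n : ℂ) + 1‖ = (n : ℝ) + 1 := by
    exact_mod_cast Complex.norm_natCast (n + 1)
  rw [norm_mul, norm_mul, norm_pow, hn1] at hrec
  have hnum : ‖(n : ℂ) ^ 2 - a ^ 2‖ ≤ (n : ℝ) ^ 2 + ‖a‖ ^ 2 :=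
    (norm_sub_le _ _).trans_eq (by rw [norm_pow, norm_pow, Complex.norm_natCast])
  have hlarge : ‖a‖ ^ 2 * ‖z‖ ≤ n * (r - ‖z‖) :=
    (div_le_iff₀ (sub_pos.2 hzr)).1 (hN.trans (Nat.cast_le.2 hn))
  have hz0 := norm_nonneg z
  have hn0 : (0 : ℝ) ≤ n := n.cast_nonneg
  have hratio : ‖(n : ℂ) ^ 2 - a ^ 2‖ * ‖z‖ ≤ r * ((n : ℝ) + 1) ^ 2 := by
    nlinarith [mul_le_mul_of_nonneg_right hnum hz0, mul_nonneg hn0 hz0,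
      mul_nonneg (sq_nonneg (n : ℝ)) (sub_nonneg.2 hzr.le), mul_nonneg hn0 (hz0.trans hzr.le)]
  rw [norm_mul, norm_mul, norm_pow, norm_pow, pow_succ]
  refine le_of_mul_le_mul_left ?_ (by positivity : (0 : ℝ) < ((n : ℝ) + 1) ^ 2)
  calc ((n : ℝ) + 1) ^ 2 * (‖hgCoeff a (n + 1)‖ * (‖z‖ ^ n * ‖z‖))
      = (((n : ℝ) + 1) ^ 2 * ‖hgCoeff a (n + 1)‖) * (‖z‖ ^ n * ‖z‖) := by ring
    _ = (‖(n : ℂ) ^ 2 - a ^ 2‖ * ‖z‖) * (‖hgCoeff a n‖ * ‖z‖ ^ n) := by rw [hrec]; ring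
    _ ≤ (r * ((n : ℝ) + 1) ^ 2) * (‖hgCoeff a n‖ * ‖z‖ ^ n) := by gcongr
    _ = ((n : ℝ) + 1) ^ 2 * (r * (‖hgCoeff a n‖ * ‖z‖ ^ n)) := by ring

theorem differentiableAt_hgSum (a : ℂ) {z : ℂ} (hz : ‖z‖ < 1) :
    DifferentiableAt ℂ (hgSum a) z :=
  (hasSum_deriv_powerSeries (fun _ => summable_hgCoeff_mul_pow a) hz).1

theorem hasSum_mul_deriv_hgSum (a : ℂ) {z : ℂ} (hz : ‖z‖ < 1) :
    HasSum (fun n : ℕ => (n * hgCoeff a n) * z ^ n) (z * deriv (hgSum a) z) :=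
  hasSum_mul_deriv_powerSeries (fun _ => summable_hgCoeff_mul_pow a) hz

/-- The hypergeometric equation `(1 - z) (z u')' = -a² u`, with the differentiability of `z u'`. -/
theorem hasDerivAt_mul_deriv_hgSum (a : ℂ) {z : ℂ} (hz : ‖z‖ < 1) :
    HasDerivAt (fun w => w * deriv (hgSum a) w) (-a ^ 2 / (1 - z) * hgSum a z) z := by
  have hb : ∀ w : ℂ, ‖w‖ < 1 → Summable fun n : ℕ => (n * hgCoeff a n) * w ^ n :=
    fun w hw => (hasSum_mul_deriv_hgSum a hw).summable
  have hz1 : 1 - z ≠ 0 := by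
    intro h
    simp [← sub_eq_zero.1 h] at hz
  have hrec : HasSum (fun n : ℕ => (((n : ℂ) + 1) * (((n + 1 : ℕ) : ℂ) * hgCoeff a (n + 1))) * z ^ n)
      (z * deriv (fun w => ∑' n : ℕ, (n * hgCoeff a n) * w ^ n) z + -a ^ 2 * hgSum a z) := by
    refine ((hasSum_mul_deriv_powerSeries hb hz).add
      ((summable_hgCoeff_mul_pow a hz).hasSum.mul_left (-a ^ 2))).congr_fun fun n => ?_
    push_cast
    linear_combination z ^ n * succ_sq_mul_hgCoeff_succ a n
  have hode := (hasSum_succ_deriv_powerSeries hb hz).unique hrec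
  have hderiv := (hasSum_deriv_powerSeries hb hz).1.hasDerivAt
  have hval : deriv (fun w => ∑' n : ℕ, (n * hgCoeff a n) * w ^ n) z =
      -a ^ 2 / (1 - z) * hgSum a z := by
    field_simp
    linear_combination hode
  rw [hval] at hderiv
  refine hderiv.congr_of_eventuallyEq ?_
  filter_upwards [Metric.isOpen_ball.mem_nhds (mem_ball_zero_iff.2 hz)] with w hw
  exact (hasSum_mul_deriv_hgSum a (mem_ball_zero_iff.1 hw)).tsum_eq.symm

/-- With `a² = −c²`, the pair `u(z) = ₂F₁(−a, a, 1; z)` and `v(z) = (z/c)u′(z)` is the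
holomorphic solution at `z = 0`, with initial value `(1, 0)`, of the Fuchsian system
`u′ = (c/z)v`, `v′ = −(c/(z−1))u` on the punctured unit disc. -/
theorem hypergeometric_solves_fuchsian_system
    (c a : ℂ) (hc : c ≠ 0) (ha : a ^ 2 = -c ^ 2) :
    DifferentiableOn ℂ (hgSum a) (Metric.ball (0 : ℂ) 1) ∧
    DifferentiableOn ℂ (fun z : ℂ => z / c * deriv (hgSum a) z) (Metric.ball (0 : ℂ) 1) ∧
    hgSum a 0 = 1 ∧
    (fun z : ℂ => z / c * deriv (hgSum a) z) 0 = 0 ∧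
    (∀ z : ℂ, 0 < ‖z‖ → ‖z‖ < 1 →
      deriv (hgSum a) z = c / z * (z / c * deriv (hgSum a) z) ∧
      deriv (fun w : ℂ => w / c * deriv (hgSum a) w) z = -(c / (z - 1)) * hgSum a z) := by
  have hv : ∀ z : ℂ, ‖z‖ < 1 →
      HasDerivAt (fun w : ℂ => w / c * deriv (hgSum a) w) (-(c / (z - 1)) * hgSum a z) z := by
    intro z hz
    have hz1 : 1 - z ≠ 0 := by
      intro h
      simp [← sub_eq_zero.1 h] at hz
    have hz2 : z - 1 ≠ 0 := by rwa [← neg_sub, neg_ne_zero]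
    simp only [div_mul_eq_mul_div]
    refine ((hasDerivAt_mul_deriv_hgSum a hz).div_const c).congr_deriv ?_
    rw [ha, ← neg_sub z 1]
    field_simp
  refine ⟨fun z hz => (differentiableAt_hgSum a (mem_ball_zero_iff.1 hz)).differentiableWithinAt,
    fun z hz => (hv z (mem_ball_zero_iff.1 hz)).differentiableAt.differentiableWithinAt,
    ?_, by simp, fun z hz0 hz => ⟨?_, (hv z hz).deriv⟩⟩
  · rw [hgSum, tsum_eq_single 0 fun n hn => by simp [hn]]
    simp [hgCoeff_zero]
  · have hz' : z ≠ 0 := norm_pos_iff.1 hz0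
    field_simp
end

section
/- Let w ∈ ℂ with Re w > 0, and for s ≥ 0 define arctan(s/(2πw)) := ∫_0^s 2πw/(4π²w² + u²) du. Then exp( (1/π) ∑_{m=1}^∞ ∫_0^∞ arctan(s/(2πw)) e^{−m s} ds ) = e^w Γ(w) exp( −(w − 1/2) Log w ) / √(2π), where Γ is the complex Gamma function and Log the principal branch of the logarithm; that is, the left-hand side equals Λ(w) := e^w Γ(w) / (√(2π) w^{w − 1/2}). -/
open MeasureTheory

/-- The complex arctangent `arctan(s/(2πw)) := ∫_0^s 2πw/(4π²w² + u²) du` for `s ≥ 0`. -/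
noncomputable def atan2piInt (w : ℂ) (s : ℝ) : ℂ :=
  ∫ u in (0 : ℝ)..s,
    2 * (Real.pi : ℂ) * w / (4 * (Real.pi : ℂ) ^ 2 * w ^ 2 + (u : ℂ) ^ 2)

section

open Filter Topology Set

theorem integral_exp_neg_mul_Ioi {b : ℂ} (hb : 0 < b.re) :
    ∫ t in Ioi (0 : ℝ), Complex.exp (-b * t) = 1 / b := by
  rw [integral_exp_mul_complex_Ioi (by simpa using hb) 0]
  simp

theorem integrableOn_exp_neg_mul_Ioi {b : ℂ} (hb : 0 < b.re) :
    IntegrableOn (fun t : ℝ => Complex.exp (-b * t)) (Ioi 0) :=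
  integrableOn_exp_mul_complex_Ioi (by simpa using hb) 0

theorem sq_add_sq_ne_zero_of_re_pos {b : ℂ} (hb : 0 < b.re) (u : ℝ) :
    b ^ 2 + (u : ℂ) ^ 2 ≠ 0 := by
  have h : b ^ 2 + (u : ℂ) ^ 2 = (b - u * Complex.I) * (b + u * Complex.I) := by
    linear_combination (u : ℂ) ^ 2 * Complex.I_sq
  rw [h]
  refine mul_ne_zero (fun h => ?_) (fun h => ?_) <;>
  · have := congrArg Complex.re h
    simp at this
    exact hb.ne' this

theorem integral_exp_neg_mul_mul_cos_Ioi {b : ℂ} (hb : 0 < b.re) (u : ℝ) :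
    ∫ t in Ioi (0 : ℝ), Complex.exp (-b * t) * Complex.cos (u * t) = b / (b ^ 2 + (u : ℂ) ^ 2) := by
  have h₁ : 0 < (b - u * Complex.I).re := by simpa using hb
  have h₂ : 0 < (b + u * Complex.I).re := by simpa using hb
  have e : ∀ t : ℝ, Complex.exp (-b * t) * Complex.cos (u * t)
      = (Complex.exp (-(b - u * Complex.I) * t) + Complex.exp (-(b + u * Complex.I) * t)) / 2 := by
    intro t
    rw [Complex.cos, mul_div_assoc', mul_add, ← Complex.exp_add, ← Complex.exp_add]
    ring_nf
  simp_rw [e]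
  rw [integral_div, integral_add (integrableOn_exp_neg_mul_Ioi h₁)
    (integrableOn_exp_neg_mul_Ioi h₂), integral_exp_neg_mul_Ioi h₁, integral_exp_neg_mul_Ioi h₂]
  have n₁ : b - u * Complex.I ≠ 0 := fun h => h₁.ne' (by rw [h]; rfl)
  have n₂ : b + u * Complex.I ≠ 0 := fun h => h₂.ne' (by rw [h]; rfl)
  have n₃ := sq_add_sq_ne_zero_of_re_pos hb u
  field_simp
  linear_combination (2 * b * (u : ℂ) ^ 2) * Complex.I_sq

theorem norm_div_sq_add_sq_le {b : ℂ} (hb : 0 < b.re) (u : ℝ) :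
    ‖b / (b ^ 2 + (u : ℂ) ^ 2)‖ ≤ 1 / b.re := by
  rw [← integral_exp_neg_mul_mul_cos_Ioi hb u]
  have hr : ∫ t in Ioi (0 : ℝ), Real.exp (-b.re * t) = 1 / b.re := by
    rw [integral_exp_mul_Ioi (by simpa using hb) 0]
    simp
  rw [← hr]
  refine norm_integral_le_of_norm_le (integrableOn_exp_mul_Ioi (by simpa using hb) 0)
    (ae_of_all _ fun t => ?_)
  rw [norm_mul, Complex.norm_exp]
  have : ‖Complex.cos (u * t)‖ ≤ 1 := by
    rw [← Complex.ofReal_mul, ← Complex.ofReal_cos, Complex.norm_real]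
    exact Real.abs_cos_le_one _
  have e : (-b * (t : ℂ)).re = -b.re * t := by simp
  rw [e]
  exact mul_le_of_le_one_right (Real.exp_pos _).le this

theorem continuous_div_sq_add_sq {b : ℂ} (hb : 0 < b.re) :
    Continuous fun u : ℝ => b / (b ^ 2 + (u : ℂ) ^ 2) :=
  Continuous.div (by fun_prop) (by fun_prop) (sq_add_sq_ne_zero_of_re_pos hb)

theorem integral_div_sq_add_sq_mul_exp {b : ℂ} (hb : 0 < b.re) {a : ℝ} (ha : 0 < a) :
    ∫ u in Ioi (0 : ℝ), b / (b ^ 2 + (u : ℂ) ^ 2) * Complex.exp (-(a : ℂ) * u)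
      = ∫ t in Ioi (0 : ℝ), Complex.exp (-b * t) * ((a : ℂ) / ((a : ℂ) ^ 2 + (t : ℂ) ^ 2)) := by
  have ha' : 0 < (a : ℂ).re := by simpa using ha
  simp_rw [← integral_exp_neg_mul_mul_cos_Ioi hb, ← integral_exp_neg_mul_mul_cos_Ioi ha',
    ← integral_mul_const, ← integral_const_mul]
  rw [integral_integral_swap]
  · refine integral_congr_ae (ae_of_all _ fun t => integral_congr_ae (ae_of_all _ fun u => ?_))
    simp only [mul_comm (u : ℂ) (t : ℂ)]
    ring
  · have h := (integrableOn_exp_neg_mul_Ioi ha').mul_prod (integrableOn_exp_neg_mul_Ioi hb)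
    refine h.mono (Continuous.aestronglyMeasurable (by fun_prop)) (ae_of_all _ fun p => ?_)
    have : ‖Complex.cos (p.1 * p.2)‖ ≤ 1 := by
      rw [← Complex.ofReal_mul, ← Complex.ofReal_cos, Complex.norm_real]
      exact Real.abs_cos_le_one _
    simp only [Function.uncurry, norm_mul]
    rw [mul_right_comm, mul_comm ‖Complex.exp (-(a : ℂ) * p.1)‖]
    exact mul_le_of_le_one_right (by positivity) this

theorem integral_atan_mul_exp {b : ℂ} (hb : 0 < b.re) {a : ℝ} (ha : 0 < a) :
    ∫ s in Ioi (0 : ℝ), (∫ u in (0 : ℝ)..s, b / (b ^ 2 + (u : ℂ) ^ 2)) * Complex.exp (-(a : ℂ) * s)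
      = ∫ t in Ioi (0 : ℝ), Complex.exp (-b * t) * (((a ^ 2 + t ^ 2)⁻¹ : ℝ) : ℂ) := by
  have ha' : 0 < (a : ℂ).re := by simpa using ha
  have hac : (a : ℂ) ≠ 0 := by exact_mod_cast ha.ne'
  set f : ℝ → ℂ := fun u => b / (b ^ 2 + (u : ℂ) ^ 2) with hf
  have hfc : Continuous f := continuous_div_sq_add_sq hb
  set A : ℝ → ℂ := fun s => ∫ u in (0 : ℝ)..s, f u with hA
  have hAd : ∀ s, HasDerivAt A (f s) s := fun s => hfc.integral_hasStrictDerivAt 0 s |>.hasDerivAt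
  have hAc : Continuous A := continuous_iff_continuousAt.2 fun s => (hAd s).continuousAt
  have hAb : ∀ s, 0 ≤ s → ‖A s‖ ≤ 1 / b.re * s := by
    intro s hs
    have := intervalIntegral.norm_integral_le_of_norm_le_const (a := 0) (b := s) (f := f)
      (fun u _ => norm_div_sq_add_sq_le hb u)
    simpa [abs_of_nonneg hs] using this
  have hne : ∀ s : ℝ, ‖Complex.exp (-(a : ℂ) * s)‖ = Real.exp (-a * s) := by
    intro s
    rw [Complex.norm_exp]
    simp
  have hAi : IntegrableOn (fun s : ℝ => A s * Complex.exp (-(a : ℂ) * s)) (Ioi 0) := by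
    have hg : IntegrableOn (fun s : ℝ => 1 / b.re * (s ^ (1 : ℝ) * Real.exp (-a * s))) (Ioi 0) :=
      Integrable.const_mul (by
        simpa [IntegrableOn] using integrableOn_rpow_mul_exp_neg_mul_rpow (p := 1) (s := 1) (by norm_num)
          one_pos ha) _
    refine hg.mono' (Continuous.aestronglyMeasurable (by fun_prop)) ?_
    refine (ae_restrict_iff' measurableSet_Ioi).2 (ae_of_all _ fun s hs => ?_)
    rw [norm_mul, hne, Real.rpow_one, ← mul_assoc]
    exact mul_le_mul_of_nonneg_right (hAb s (mem_Ioi.1 hs).le) (Real.exp_pos _).le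
  have hfi : IntegrableOn (fun s : ℝ => f s * Complex.exp (-(a : ℂ) * s)) (Ioi 0) := by
    refine (integrableOn_exp_neg_mul_Ioi ha').bdd_mul (c := 1 / b.re)
      hfc.aestronglyMeasurable (ae_of_all _ fun s => ?_)
    exact norm_div_sq_add_sq_le hb s
  have hed : ∀ s : ℝ, HasDerivAt (fun s : ℝ => Complex.exp (-(a : ℂ) * s))
      (Complex.exp (-(a : ℂ) * s) * -(a : ℂ)) s := by
    intro s
    have := ((hasDerivAt_id (s : ℂ)).const_mul (-(a : ℂ))).cexp.comp_ofReal
    simpa using this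
  have key := integral_Ioi_of_hasDerivAt_of_tendsto (a := 0) (m := (0 : ℂ))
    (f := fun s : ℝ => A s * Complex.exp (-(a : ℂ) * s))
    (f' := fun s : ℝ => f s * Complex.exp (-(a : ℂ) * s)
      + A s * (Complex.exp (-(a : ℂ) * s) * -(a : ℂ)))
    (by fun_prop) (fun s _ => (hAd s).mul (hed s))
    (hfi.add (by simpa only [IntegrableOn, ← mul_assoc] using hAi.mul_const (-(a : ℂ)))) (by
      have hz : Tendsto (fun s : ℝ => 1 / b.re * (s ^ (1 : ℝ) * Real.exp (-a * s))) atTop (𝓝 0) := by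
        simpa using (tendsto_rpow_mul_exp_neg_mul_atTop_nhds_zero 1 a ha).const_mul (1 / b.re)
      refine squeeze_zero_norm' ?_ hz
      filter_upwards [eventually_ge_atTop 0] with s hs
      rw [norm_mul, hne, Real.rpow_one, ← mul_assoc]
      exact mul_le_mul_of_nonneg_right (hAb s hs) (Real.exp_pos _).le)
  simp_rw [← mul_assoc] at key
  rw [integral_add hfi (hAi.mul_const _), integral_mul_const,
    integral_div_sq_add_sq_mul_exp hb ha] at key
  have h0 : A 0 = 0 := by simp [hA]
  rw [h0] at key
  have e : ∀ t : ℝ, Complex.exp (-b * t) * ((a : ℂ) / ((a : ℂ) ^ 2 + (t : ℂ) ^ 2))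
      = a * (Complex.exp (-b * t) * (((a ^ 2 + t ^ 2)⁻¹ : ℝ) : ℂ)) := by
    intro t
    push_cast
    ring
  simp_rw [e] at key
  rw [integral_const_mul] at key
  apply mul_left_cancel₀ hac
  linear_combination -key

theorem summable_inv_succ_sq : Summable fun m : ℕ => (((m : ℝ) + 1) ^ 2)⁻¹ := by
  have h := (summable_nat_add_iff 1).2 (Real.summable_nat_pow_inv.2 one_lt_two)
  simpa using h

theorem inv_sq_add_sq_le (m : ℕ) (t : ℝ) :
    (((m : ℝ) + 1) ^ 2 + t ^ 2)⁻¹ ≤ (((m : ℝ) + 1) ^ 2)⁻¹ :=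
  inv_anti₀ (by positivity) (by nlinarith [sq_nonneg t])

theorem summable_inv_sq_add_sq (t : ℝ) : Summable fun m : ℕ => (((m : ℝ) + 1) ^ 2 + t ^ 2)⁻¹ :=
  summable_inv_succ_sq.of_nonneg_of_le (fun _ => by positivity) (inv_sq_add_sq_le · t)

/-- The Mittag-Leffler sum `∑_{m ≥ 1} 1 / (m² + t²)`. -/
noncomputable def latticeSum (t : ℝ) : ℝ := ∑' m : ℕ, (((m : ℝ) + 1) ^ 2 + t ^ 2)⁻¹

theorem norm_latticeSum_le (t : ℝ) : ‖(latticeSum t : ℂ)‖ ≤ latticeSum 0 := by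
  have h : 0 ≤ latticeSum t := tsum_nonneg fun _ => by positivity
  rw [Complex.norm_real, Real.norm_of_nonneg h]
  exact (summable_inv_sq_add_sq t).tsum_le_tsum (fun m => by simpa using inv_sq_add_sq_le m t)
    (summable_inv_sq_add_sq 0)

theorem measurable_latticeSum : Measurable latticeSum := by
  unfold latticeSum
  exact Measurable.tsum fun m => by fun_prop

theorem norm_exp_neg_mul (b : ℂ) (t : ℝ) : ‖Complex.exp (-b * t)‖ = Real.exp (-b.re * t) := by
  rw [Complex.norm_exp]
  simp

theorem integrableOn_exp_mul_latticeSum {b : ℂ} (hb : 0 < b.re) :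
    IntegrableOn (fun t : ℝ => Complex.exp (-b * t) * (latticeSum t : ℂ)) (Ioi 0) :=
  (integrableOn_exp_neg_mul_Ioi hb).mul_bdd (c := latticeSum 0)
    (Complex.measurable_ofReal.comp measurable_latticeSum).aestronglyMeasurable
    (ae_of_all _ norm_latticeSum_le)

/-- Binet's function `(1/π) ∫_0^∞ e^{-2πwt} ∑_{m ≥ 1} 1 / (m² + t²) dt`. -/
noncomputable def binetIntegral (w : ℂ) : ℂ :=
  (Real.pi : ℂ)⁻¹ *
    ∫ t in Ioi (0 : ℝ), Complex.exp (-(2 * Real.pi * w) * t) * (latticeSum t : ℂ)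

theorem two_pi_mul_re_pos {w : ℂ} (hw : 0 < w.re) : 0 < (2 * Real.pi * w : ℂ).re := by
  have : (2 * Real.pi * w : ℂ).re = 2 * Real.pi * w.re := by simp
  rw [this]
  positivity

theorem hasSum_integral_exp_mul_inv {b : ℂ} (hb : 0 < b.re) :
    HasSum (fun m : ℕ => ∫ t in Ioi (0 : ℝ),
        Complex.exp (-b * t) * (((((m : ℝ) + 1) ^ 2 + t ^ 2)⁻¹ : ℝ) : ℂ))
      (∫ t in Ioi (0 : ℝ), Complex.exp (-b * t) * (latticeSum t : ℂ)) := by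
  refine hasSum_integral_of_dominated_convergence
    (fun m t => Real.exp (-b.re * t) * (((m : ℝ) + 1) ^ 2)⁻¹) (fun m => ?_) (fun m => ?_) ?_ ?_ ?_
  · exact Measurable.aestronglyMeasurable (by fun_prop)
  · refine ae_of_all _ fun t => ?_
    rw [norm_mul, norm_exp_neg_mul, Complex.norm_real, Real.norm_of_nonneg (by positivity)]
    exact mul_le_mul_of_nonneg_left (inv_sq_add_sq_le m t) (Real.exp_pos _).le
  · exact ae_of_all _ fun t => summable_inv_succ_sq.mul_left _
  · simp_rw [tsum_mul_left]
    exact (integrableOn_exp_mul_Ioi (by simpa using hb) 0).mul_const _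
  · exact ae_of_all _ fun t =>
      (Complex.hasSum_ofReal.2 (summable_inv_sq_add_sq t).hasSum).mul_left _

theorem tsum_integral_atan2piInt {w : ℂ} (hw : 0 < w.re) :
    (Real.pi : ℂ)⁻¹ * ∑' m : ℕ, ∫ s in Ioi (0 : ℝ),
        atan2piInt w s * (Real.exp (-((m : ℝ) + 1) * s) : ℂ) = binetIntegral w := by
  have hb := two_pi_mul_re_pos hw
  rw [binetIntegral, ← (hasSum_integral_exp_mul_inv hb).tsum_eq]
  congr 2
  ext m
  rw [← integral_atan_mul_exp hb (a := (m : ℝ) + 1) (by positivity)]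
  refine integral_congr_ae (ae_of_all _ fun s => ?_)
  simp only [atan2piInt]
  congr 2
  · ext u
    congr 2
    ring
  · push_cast
    rfl

theorem tendsto_binetIntegral_add_nat {w : ℂ} (hw : 0 < w.re) :
    Tendsto (fun n : ℕ => binetIntegral (w + n)) atTop (𝓝 0) := by
  have hbd : ∀ n : ℕ, ‖binetIntegral (w + n)‖
      ≤ Real.pi⁻¹ * (latticeSum 0 * (1 / (2 * Real.pi * (w.re + n)))) := by
    intro n
    have hn : 0 < (w + n).re := by
      simp only [Complex.add_re, Complex.natCast_re]
      positivity
    have hb := two_pi_mul_re_pos hn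
    have hr : (2 * Real.pi * (w + n) : ℂ).re = 2 * Real.pi * (w.re + n) := by simp
    rw [binetIntegral, norm_mul, norm_inv, Complex.norm_real, Real.norm_of_nonneg Real.pi_pos.le]
    refine mul_le_mul_of_nonneg_left ?_ (by positivity)
    rw [hr] at hb
    have hi : ∫ t in Ioi (0 : ℝ), Real.exp (-(2 * Real.pi * (w.re + n)) * t)
        = 1 / (2 * Real.pi * (w.re + n)) := by
      rw [integral_exp_mul_Ioi (by linarith) 0]
      simp
    rw [← hi, ← integral_const_mul]
    refine norm_integral_le_of_norm_le
      ((integrableOn_exp_mul_Ioi (by linarith) 0).const_mul _) (ae_of_all _ fun t => ?_)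
    rw [norm_mul, norm_exp_neg_mul, hr, mul_comm]
    exact mul_le_mul_of_nonneg_right (norm_latticeSum_le t) (Real.exp_pos _).le
  refine squeeze_zero_norm hbd ?_
  have h1 : Tendsto (fun n : ℕ => 2 * Real.pi * (w.re + n)) atTop atTop :=
    (tendsto_atTop_add_const_left _ _ tendsto_natCast_atTop_atTop).const_mul_atTop (by positivity)
  simpa using ((h1.inv_tendsto_atTop.const_mul (latticeSum 0)).const_mul Real.pi⁻¹)

theorem one_sub_exp_mul_latticeSum {t : ℝ} (ht : 0 < t) :
    (1 - Complex.exp (-(2 * Real.pi) * t)) * (latticeSum t : ℂ)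
      = Real.pi * (1 + Complex.exp (-(2 * Real.pi) * t)) / (2 * t)
        - (1 - Complex.exp (-(2 * Real.pi) * t)) / (2 * t ^ 2) := by
  have ht' : (t : ℂ) ≠ 0 := by exact_mod_cast ht.ne'
  have hz : (Complex.I * t) ∈ Complex.integerComplement := by
    rw [Complex.mem_integerComplement_iff]
    rintro ⟨n, hn⟩
    have := congrArg Complex.im hn
    simp at this
    exact ht.ne this
  have h := cot_series_rep' hz
  have hE : 1 - Complex.exp (-(2 * Real.pi) * t) ≠ 0 := by
    have hlt : Real.exp (-(2 * Real.pi) * t) < 1 := Real.exp_lt_one_iff.2 (by nlinarith [Real.pi_pos])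
    have : (1 - Real.exp (-(2 * Real.pi) * t) : ℂ) ≠ 0 := by
      exact_mod_cast (sub_pos.2 hlt).ne'
    simpa using this
  have hs : ∑' n : ℕ, (1 / (Complex.I * t - (n + 1)) + 1 / (Complex.I * t + (n + 1)))
      = -2 * Complex.I * t * (latticeSum t : ℂ) := by
    rw [latticeSum, Complex.ofReal_tsum, ← tsum_mul_left]
    congr 1
    ext n
    have hn : (0 : ℝ) < (n : ℝ) + 1 := by positivity
    have n1 : Complex.I * t - (n + 1) ≠ 0 := fun h0 => by
      have := congrArg Complex.im h0
      simp at this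
      exact ht.ne' this
    have n2 : Complex.I * t + (n + 1) ≠ 0 := fun h0 => by
      have := congrArg Complex.im h0
      simp at this
      exact ht.ne' this
    have n3 : ((n : ℂ) + 1) ^ 2 + (t : ℂ) ^ 2 ≠ 0 := by
      exact_mod_cast (by positivity : (0 : ℝ) < ((n : ℝ) + 1) ^ 2 + t ^ 2).ne'
    push_cast
    field_simp
    linear_combination (2 * Complex.I * t ^ 3) * Complex.I_sq
  rw [hs, Complex.cot_pi_eq_exp_ratio] at h
  have he : 2 * Real.pi * Complex.I * (Complex.I * t) = -(2 * Real.pi) * (t : ℂ) := by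
    linear_combination (2 * Real.pi * t : ℂ) * Complex.I_sq
  rw [he] at h
  set E := Complex.exp (-(2 * Real.pi) * t)
  field_simp at h ⊢
  grind [Complex.I_sq]

theorem integral_half_sub_mul_exp {t : ℝ} (ht : 0 < t) :
    (2 * Real.pi ^ 2 : ℂ) *
        ∫ x in (0 : ℝ)..1, (1 / 2 - x : ℂ) * Complex.exp (-(2 * Real.pi * x) * t)
      = (1 - Complex.exp (-(2 * Real.pi) * t)) * (latticeSum t : ℂ) := by
  have ht' : (t : ℂ) ≠ 0 := by exact_mod_cast ht.ne'
  have hp : (Real.pi : ℂ) ≠ 0 := by exact_mod_cast Real.pi_ne_zero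
  rw [one_sub_exp_mul_latticeSum ht]
  have hd : ∀ x : ℝ, HasDerivAt (fun x : ℝ => Complex.exp (-(2 * Real.pi * x) * t) *
      ((x - 1 / 2 : ℂ) / (2 * Real.pi * t) + 1 / (2 * Real.pi * t) ^ 2))
      ((1 / 2 - x : ℂ) * Complex.exp (-(2 * Real.pi * x) * t)) x := by
    intro x
    have h1 : HasDerivAt (fun z : ℂ => Complex.exp (-(2 * Real.pi * z) * t) *
        ((z - 1 / 2 : ℂ) / (2 * Real.pi * t) + 1 / (2 * Real.pi * t) ^ 2))
        (Complex.exp (-(2 * Real.pi * x) * t) * (-(2 * Real.pi * 1) * t) *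
          ((x - 1 / 2 : ℂ) / (2 * Real.pi * t) + 1 / (2 * Real.pi * t) ^ 2) +
          Complex.exp (-(2 * Real.pi * x) * t) * (1 / (2 * Real.pi * t))) (x : ℂ) := by
      refine HasDerivAt.mul ?_ ?_
      · exact ((((hasDerivAt_id (x : ℂ)).const_mul _).neg).mul_const _).cexp
      · exact (((hasDerivAt_id (x : ℂ)).sub_const _).div_const _).add_const _
    convert h1.comp_ofReal using 1
    field_simp
    ring
  rw [intervalIntegral.integral_eq_sub_of_hasDerivAt (fun x _ => hd x)
    (Continuous.intervalIntegrable (by fun_prop) _ _)]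
  simp only [Complex.ofReal_one, Complex.ofReal_zero, mul_one, mul_zero, neg_zero, zero_mul,
    Complex.exp_zero]
  field_simp
  ring

theorem integral_half_sub_div {w : ℂ} (hw : 0 < w.re) :
    ∫ x in (0 : ℝ)..1, (1 / 2 - x : ℂ) * (1 / (w + x))
      = (w + 1 / 2) * (Complex.log (w + 1) - Complex.log w) - 1 := by
  have hre : ∀ x ∈ uIcc (0 : ℝ) 1, 0 < (w + x).re := by
    intro x hx
    rw [uIcc_of_le zero_le_one] at hx
    simpa using add_pos_of_pos_of_nonneg hw hx.1
  have hne : ∀ x ∈ uIcc (0 : ℝ) 1, w + x ≠ 0 := fun x hx h => (hre x hx).ne' (by rw [h]; rfl)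
  have hd : ∀ x ∈ uIcc (0 : ℝ) 1,
      HasDerivAt (fun x : ℝ => (w + 1 / 2) * Complex.log (w + x) - x)
        ((1 / 2 - x : ℂ) * (1 / (w + x))) x := by
    intro x hx
    have h1 : HasDerivAt (fun z : ℂ => (w + 1 / 2) * Complex.log (w + z) - z)
        ((w + 1 / 2) * (1 / (w + x)) - 1) (x : ℂ) :=
      ((((hasDerivAt_id (x : ℂ)).const_add w).clog (Or.inl (hre x hx))).const_mul _).sub
        (hasDerivAt_id _)
    convert h1.comp_ofReal using 1
    have := hne x hx
    field_simp
    ring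
  rw [intervalIntegral.integral_eq_sub_of_hasDerivAt hd]
  · simp only [Complex.ofReal_one, Complex.ofReal_zero, add_zero]
    ring
  · refine ContinuousOn.intervalIntegrable (ContinuousOn.mul (by fun_prop) ?_)
    exact ContinuousOn.div (by fun_prop) (by fun_prop) hne

theorem binetIntegral_sub_add_one {w : ℂ} (hw : 0 < w.re) :
    binetIntegral w - binetIntegral (w + 1)
      = (w + 1 / 2) * (Complex.log (w + 1) - Complex.log w) - 1 := by
  have hp : (Real.pi : ℂ) ≠ 0 := by exact_mod_cast Real.pi_ne_zero
  have hw1 : 0 < (w + 1).re := by simpa using add_pos hw one_pos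
  rw [← integral_half_sub_div hw, binetIntegral, binetIntegral, ← mul_sub,
    ← integral_sub (integrableOn_exp_mul_latticeSum (two_pi_mul_re_pos hw))
      (integrableOn_exp_mul_latticeSum (two_pi_mul_re_pos hw1))]
  have e1 : ∫ t in Ioi (0 : ℝ), (Complex.exp (-(2 * Real.pi * w) * t) * (latticeSum t : ℂ)
        - Complex.exp (-(2 * Real.pi * (w + 1)) * t) * (latticeSum t : ℂ))
      = ∫ t in Ioi (0 : ℝ), (2 * Real.pi ^ 2 : ℂ) * ∫ x in Ioc (0 : ℝ) 1,
          (1 / 2 - x : ℂ) * Complex.exp (-(2 * Real.pi * (w + x)) * t) := by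
    refine setIntegral_congr_fun measurableSet_Ioi fun t ht => ?_
    have h := integral_half_sub_mul_exp (mem_Ioi.1 ht)
    rw [intervalIntegral.integral_of_le zero_le_one] at h
    have e2 : Complex.exp (-(2 * Real.pi * (w + 1)) * t)
        = Complex.exp (-(2 * Real.pi * w) * t) * Complex.exp (-(2 * Real.pi) * t) := by
      rw [← Complex.exp_add]
      ring_nf
    have e3 : ∀ x : ℝ, (1 / 2 - x : ℂ) * Complex.exp (-(2 * Real.pi * (w + x)) * t)
        = Complex.exp (-(2 * Real.pi * w) * t) *
          ((1 / 2 - x : ℂ) * Complex.exp (-(2 * Real.pi * x) * t)) := by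
      intro x
      rw [mul_left_comm, ← Complex.exp_add]
      ring_nf
    simp only [e2, e3]
    rw [integral_const_mul]
    linear_combination -Complex.exp (-(2 * Real.pi * w) * t) * h
  rw [e1, integral_const_mul, integral_integral_swap, intervalIntegral.integral_of_le zero_le_one,
    ← integral_const_mul, ← integral_const_mul]
  · refine setIntegral_congr_fun measurableSet_Ioc fun x hx => ?_
    have hx' : 0 < (w + x).re := by simpa using add_pos hw hx.1
    have hne : w + x ≠ 0 := fun h => hx'.ne' (by rw [h]; rfl)
    rw [integral_const_mul, integral_exp_neg_mul_Ioi (two_pi_mul_re_pos hx')]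
    field_simp
  · have h := (integrableOn_exp_neg_mul_Ioi (two_pi_mul_re_pos hw)).mul_prod
      (integrableOn_const (μ := volume) (s := Ioc (0 : ℝ) 1) (C := (1 : ℂ)) (by simp))
    refine h.mono (Continuous.aestronglyMeasurable (by fun_prop)) ?_
    rw [Measure.prod_restrict]
    refine (ae_restrict_iff' (measurableSet_Ioi.prod measurableSet_Ioc)).2 (ae_of_all _ ?_)
    rintro ⟨t, x⟩ ⟨ht, hx⟩
    simp only [mem_Ioi, mem_Ioc] at ht hx
    have n1 : ‖(1 / 2 - x : ℂ)‖ ≤ 1 := by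
      rw [show (1 / 2 - x : ℂ) = ((1 / 2 - x : ℝ) : ℂ) by push_cast; rfl, Complex.norm_real,
        Real.norm_eq_abs, abs_le]
      constructor <;> linarith [hx.1, hx.2]
    have n2 : ‖Complex.exp (-(2 * Real.pi * (w + x)) * t)‖
        ≤ ‖Complex.exp (-(2 * Real.pi * w) * t)‖ := by
      rw [norm_exp_neg_mul, norm_exp_neg_mul, Real.exp_le_exp]
      have : 0 ≤ Real.pi * x * t := by have := Real.pi_pos; have := hx.1; positivity
      simp
      linarith
    simp only [Function.uncurry, norm_mul, mul_one]
    calc _ ≤ 1 * ‖Complex.exp (-(2 * Real.pi * (w + x)) * t)‖ := by gcongr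
      _ ≤ _ := by rw [one_mul]; exact n2

/-- The normalized Gamma function `e^w Γ(w) / (√(2π) w^{w - 1/2})`. -/
noncomputable def normalizedGamma (w : ℂ) : ℂ :=
  Complex.exp w * Complex.Gamma w
    * Complex.exp (-(w - 1 / 2) * Complex.log w) / (Real.sqrt (2 * Real.pi) : ℂ)

theorem normalizedGamma_eq_exp_mul {w : ℂ} (hw : 0 < w.re) :
    normalizedGamma w
      = Complex.exp ((w + 1 / 2) * (Complex.log (w + 1) - Complex.log w) - 1)
        * normalizedGamma (w + 1) := by
  have hne : w ≠ 0 := fun h => hw.ne' (by rw [h]; rfl)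
  have hG : Complex.Gamma (w + 1) = Complex.exp (Complex.log w) * Complex.Gamma w := by
    rw [Complex.Gamma_add_one w hne, Complex.exp_log hne]
  rw [normalizedGamma, normalizedGamma, hG]
  have : ∀ a b c d g s : ℂ, Complex.exp a * (Complex.exp b * (Complex.exp c * g) * Complex.exp d / s)
      = Complex.exp (a + b + c + d) * g / s := by
    intro a b c d g s
    simp only [Complex.exp_add]
    ring
  rw [this, mul_right_comm, ← Complex.exp_add]
  ring_nf

theorem normalizedGamma_mul_exp_neg_add_nat {w : ℂ} (hw : 0 < w.re) (n : ℕ) :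
    normalizedGamma (w + n) * Complex.exp (-binetIntegral (w + n))
      = normalizedGamma w * Complex.exp (-binetIntegral w) := by
  induction n with
  | zero => simp
  | succ n ih =>
    have hn : 0 < (w + n).re := by
      simp only [Complex.add_re, Complex.natCast_re]
      positivity
    rw [← ih, normalizedGamma_eq_exp_mul hn, ← binetIntegral_sub_add_one hn]
    push_cast
    rw [← add_assoc, mul_right_comm, ← Complex.exp_add]
    ring_nf

theorem Gamma_mul_natCast_cpow_mul_factorial {w : ℂ} (hw : 0 < w.re) (n : ℕ) :
    Complex.Gamma w * ((n : ℂ) ^ w * (n.factorial : ℂ))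
      = Complex.GammaSeq w n * Complex.Gamma (w + (n + 1 : ℕ)) := by
  have h : ∀ k : ℕ, w + k ≠ 0 := fun k hk => by
    have := congrArg Complex.re hk
    simp at this
    have : (0 : ℝ) ≤ k := k.cast_nonneg
    linarith
  have hG : ∀ k : ℕ, Complex.Gamma (w + k)
      = (∏ j ∈ Finset.range k, (w + j)) * Complex.Gamma w := by
    intro k
    induction k with
    | zero => simp
    | succ k ih =>
      rw [Finset.prod_range_succ]
      push_cast
      rw [← add_assoc, Complex.Gamma_add_one _ (h k), ih]
      ring
  rw [hG, Complex.GammaSeq]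
  have := Finset.prod_ne_zero_iff.2 fun j (_ : j ∈ Finset.range (n + 1)) => h j
  field_simp

theorem tendsto_normalizedGamma_add_nat {w : ℂ} (hw : 0 < w.re) :
    Tendsto (fun n : ℕ => normalizedGamma (w + (n + 1 : ℕ))) atTop (𝓝 1) := by
  have hG : Complex.Gamma w ≠ 0 := Complex.Gamma_ne_zero_of_re_pos hw
  have hpi : (0 : ℝ) < √Real.pi := Real.sqrt_pos.2 Real.pi_pos
  have t1 : Tendsto (fun n : ℕ => Complex.Gamma w / Complex.GammaSeq w n) atTop (𝓝 1) := by
    have := (tendsto_const_nhds (x := Complex.Gamma w)).div (Complex.GammaSeq_tendsto_Gamma w) hG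
    rwa [div_self hG] at this
  have t2 : Tendsto (fun n : ℕ => ((Stirling.stirlingSeq n / √Real.pi : ℝ) : ℂ)) atTop (𝓝 1) := by
    have := Stirling.tendsto_stirlingSeq_sqrt_pi.div_const √Real.pi
    rw [div_self hpi.ne'] at this
    exact_mod_cast (Complex.continuous_ofReal.tendsto 1).comp this
  have t3 : Tendsto (fun n : ℕ => (n : ℂ) * Complex.log (1 + (w + 1) / n)) atTop (𝓝 (w + 1)) := by
    refine Complex.tendsto_nat_mul_log_one_add_of_tendsto (tendsto_const_nhds.congr' ?_)
    filter_upwards [eventually_ne_atTop 0] with n hn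
    have : (n : ℂ) ≠ 0 := by exact_mod_cast hn
    field_simp
  have t4 : Tendsto (fun n : ℕ => Complex.log (1 + (w + 1) / n)) atTop (𝓝 0) := by
    have := (tendsto_inv_atTop_nhds_zero_nat (𝕜 := ℂ)).mul t3
    rw [zero_mul] at this
    refine this.congr' ?_
    filter_upwards [eventually_ne_atTop 0] with n hn
    have : (n : ℂ) ≠ 0 := by exact_mod_cast hn
    field_simp
  have t5 : Tendsto (fun n : ℕ => Complex.exp (w + 1 - ((n : ℂ) * Complex.log (1 + (w + 1) / n)
      + (w + 1 / 2) * Complex.log (1 + (w + 1) / n)))) atTop (𝓝 1) := by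
    have := (t3.add (t4.const_mul (w + 1 / 2))).const_sub (w + 1)
    simpa using this.cexp
  have t := (t1.mul t2).mul t5
  simp only [mul_one] at t
  refine t.congr' ?_
  have hS : ∀ᶠ n in atTop, Complex.GammaSeq w n ≠ 0 :=
    (Complex.GammaSeq_tendsto_Gamma w).eventually_ne hG
  filter_upwards [eventually_ne_atTop 0, hS] with n hn hSn
  have hnr : (0 : ℝ) < n := by exact_mod_cast Nat.pos_of_ne_zero hn
  have hnc : (n : ℂ) ≠ 0 := by exact_mod_cast hn
  have hΓ : Complex.Gamma (w + (n + 1 : ℕ))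
      = Complex.Gamma w / Complex.GammaSeq w n * ((n : ℂ) ^ w * (n.factorial : ℂ)) := by
    field_simp
    linear_combination -Gamma_mul_natCast_cpow_mul_factorial hw n
  have hlog : Complex.log (w + (n + 1 : ℕ))
      = Real.log n + Complex.log (1 + (w + 1) / n) := by
    rw [← Complex.log_ofReal_mul hnr]
    · congr 1
      push_cast
      field_simp
      ring
    · intro h0
      have := congrArg Complex.re (show (n : ℂ) + (w + 1) = 0 by
        field_simp at h0
        simpa using h0)
      simp at this
      linarith
  have hfac : (n.factorial : ℂ) = ((Stirling.stirlingSeq n / √Real.pi : ℝ) : ℂ) *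
      (Real.sqrt (2 * Real.pi) : ℂ) * Complex.exp (Real.log n / 2 + n * Real.log n - n) := by
    have hr : (n.factorial : ℝ) = Stirling.stirlingSeq n / √Real.pi *
        √(2 * Real.pi) * Real.exp (Real.log n / 2 + n * Real.log n - n) := by
      have hsq : Real.exp (Real.log n / 2) = √n := by
        rw [Real.exp_half, Real.exp_log hnr]
      have hpw : Real.exp (n * Real.log n) = (n : ℝ) ^ n := by
        rw [Real.exp_nat_mul, Real.exp_log hnr]
      have hen : Real.exp n = Real.exp 1 ^ n := by
        rw [← Real.exp_nat_mul, mul_one]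
      rw [Real.exp_sub, Real.exp_add, hsq, hpw, hen, Stirling.stirlingSeq, div_pow,
        Real.sqrt_mul zero_le_two, Real.sqrt_mul zero_le_two]
      have : 0 < √(n : ℝ) := Real.sqrt_pos.2 hnr
      field_simp
    exact_mod_cast congrArg (fun x : ℝ => (x : ℂ)) hr
  have hs2 : (Real.sqrt (2 * Real.pi) : ℂ) ≠ 0 := by
    exact_mod_cast (Real.sqrt_pos.2 (by positivity)).ne'
  have hcp : (n : ℂ) ^ w = Complex.exp (Real.log n * w) := by
    rw [Complex.cpow_def_of_ne_zero hnc, Complex.natCast_log]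
  rw [normalizedGamma, hΓ, hlog, hfac, hcp]
  have hcomb : ∀ a b c d A S q : ℂ, q ≠ 0 → Complex.exp a * (A * (Complex.exp b *
      (S * q * Complex.exp c))) * Complex.exp d / q = A * S * Complex.exp (a + b + c + d) := by
    intro a b c d A S q hq
    simp only [Complex.exp_add]
    field_simp
  rw [hcomb _ _ _ _ _ _ _ hs2]
  congr 2
  push_cast
  ring

theorem exp_binetIntegral {w : ℂ} (hw : 0 < w.re) :
    Complex.exp (binetIntegral w) = normalizedGamma w := by
  have h1 := tendsto_normalizedGamma_add_nat hw
  have h2 := ((tendsto_binetIntegral_add_nat hw).comp (tendsto_add_atTop_nat 1)).neg.cexp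
  have h := h1.mul h2
  simp only [Function.comp_def, normalizedGamma_mul_exp_neg_add_nat hw, neg_zero,
    Complex.exp_zero, mul_one] at h
  have := tendsto_nhds_unique h tendsto_const_nhds
  rw [Complex.exp_neg] at this
  have hne := Complex.exp_ne_zero (binetIntegral w)
  field_simp at this
  exact this

end

/-- Binet's formula, summed over frequencies: for `Re w > 0`,
`exp((1/π) ∑_{m≥1} ∫_0^∞ arctan(s/(2πw)) e^{−ms} ds) = e^w Γ(w) / (√(2π) w^{w−1/2})`,
the right-hand side being the function `Λ(w)` with `w^{w−1/2} = exp((w−1/2) Log w)`. -/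
theorem oscillator_sum_equals_Lambda (w : ℂ) (hw : 0 < w.re) :
    Complex.exp ((Real.pi : ℂ)⁻¹ *
        ∑' m : ℕ, ∫ s in Set.Ioi (0 : ℝ),
          atan2piInt w s * (Real.exp (-((m : ℝ) + 1) * s) : ℂ))
      = Complex.exp w * Complex.Gamma w
          * Complex.exp (-(w - 1 / 2) * Complex.log w) / (Real.sqrt (2 * Real.pi) : ℂ) := by
  rw [tsum_integral_atan2piInt hw, exp_binetIntegral hw, normalizedGamma]
end

section
/- Fix an integer m ≥ 1 and let D = {(t, Z) ∈ ℂ* × ℂ : Re(Z/t) > 0}. For (t, Z) ∈ D define F(t, Z) = ∫_0^∞ ( ∫_0^s (Z/t)/((Z/t)² + u²) du ) e^{−m s} ds (i.e. F(t,Z) = ∫_0^∞ arctan(s/(Z/t)) e^{−ms} ds with arctan(s/w) := ∫_0^s w/(w²+u²) du) and G(t, Z) = (1/2) ∫_0^∞ s · Log( s² + (Z/t)² ) e^{−m s} ds, where Log is the principal branch (note s² + (Z/t)² lies off the nonpositive real axis for s ≥ 0 when Re(Z/t) > 0). Then for every (t, Z) ∈ D the complex partial derivatives exist and ∂F/∂t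 (t, Z) = ∂G/∂Z (t, Z), where ∂/∂t is the complex derivative in t with Z fixed and ∂/∂Z the complex derivative in Z with t fixed. -/
open MeasureTheory

/-- `F(t, Z) = ∫_0^∞ arctan(s/(Z/t)) e^{−ms} ds` where
`arctan(s/w) := ∫_0^s w/(w² + u²) du`. -/
noncomputable def oscF (m : ℕ) (t Z : ℂ) : ℂ :=
  ∫ s in Set.Ioi (0 : ℝ),
    (∫ u in (0 : ℝ)..s, (Z / t) / ((Z / t) ^ 2 + (u : ℂ) ^ 2))
      * (Real.exp (-(m : ℝ) * s) : ℂ)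

/-- `G(t, Z) = (1/2) ∫_0^∞ s Log(s² + (Z/t)²) e^{−ms} ds` with the principal branch. -/
noncomputable def oscG (m : ℕ) (t Z : ℂ) : ℂ :=
  (1 / 2 : ℂ) * ∫ s in Set.Ioi (0 : ℝ),
    (s : ℂ) * Complex.log ((s : ℂ) ^ 2 + (Z / t) ^ 2) * (Real.exp (-(m : ℝ) * s) : ℂ)

namespace Oscillator

open Complex Set Filter Topology

lemma add_mul_I_re (w : ℂ) (s : ℝ) : (w + s * I).re = w.re := by simp

lemma sub_mul_I_re (w : ℂ) (s : ℝ) : (w - s * I).re = w.re := by simp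

lemma sq_add_sq_eq_mul (w s : ℂ) : w ^ 2 + s ^ 2 = (w + s * I) * (w - s * I) := by
  linear_combination s ^ 2 * I_sq

lemma add_mul_I_ne_zero {w : ℂ} (hw : 0 < w.re) (s : ℝ) : w + s * I ≠ 0 :=
  Complex.ne_zero_of_re_pos (by simpa using hw)

lemma sub_mul_I_ne_zero {w : ℂ} (hw : 0 < w.re) (s : ℝ) : w - s * I ≠ 0 :=
  Complex.ne_zero_of_re_pos (by simpa using hw)

lemma sq_add_sq_ne_zero {w : ℂ} (hw : 0 < w.re) (s : ℝ) : w ^ 2 + (s : ℂ) ^ 2 ≠ 0 := by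
  rw [sq_add_sq_eq_mul]
  exact mul_ne_zero (add_mul_I_ne_zero hw s) (sub_mul_I_ne_zero hw s)

lemma inv_add_mul_I_add_inv {w : ℂ} (hw : 0 < w.re) (s : ℝ) :
    (w + s * I)⁻¹ + (w - s * I)⁻¹ = 2 * (w / (w ^ 2 + (s : ℂ) ^ 2)) := by
  rw [inv_add_inv (add_mul_I_ne_zero hw s) (sub_mul_I_ne_zero hw s), sq_add_sq_eq_mul]
  ring

lemma inv_add_mul_I_sub_inv {w : ℂ} (hw : 0 < w.re) (s : ℝ) :
    (w + s * I)⁻¹ - (w - s * I)⁻¹ = -(2 * I) * (s / (w ^ 2 + (s : ℂ) ^ 2)) := by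
  rw [inv_sub_inv (add_mul_I_ne_zero hw s) (sub_mul_I_ne_zero hw s), sq_add_sq_eq_mul]
  ring

lemma sq_add_sq_mem_slitPlane {w : ℂ} (hw : 0 < w.re) (s : ℝ) :
    (s : ℂ) ^ 2 + w ^ 2 ∈ slitPlane := by
  rw [mem_slitPlane_iff]
  by_cases h : w.im = 0
  · left
    simp only [pow_two, add_re, mul_re, ofReal_re, ofReal_im, h]
    nlinarith [mul_self_nonneg s, mul_pos hw hw]
  · right
    simp only [pow_two, add_im, mul_im, ofReal_re, ofReal_im]
    intro h0
    apply mul_ne_zero hw.ne' h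
    linarith

lemma sq_le_norm_sq_add_sq {r : ℝ} (hr : 0 < r) {w : ℂ} (hw : r ≤ w.re) (s : ℝ) :
    r ^ 2 ≤ ‖w ^ 2 + (s : ℂ) ^ 2‖ := by
  rw [sq_add_sq_eq_mul, norm_mul, pow_two]
  have h1 : r ≤ ‖w + s * I‖ := hw.trans ((add_mul_I_re w s).ge.trans (re_le_norm _))
  have h2 : r ≤ ‖w - s * I‖ := hw.trans ((sub_mul_I_re w s).ge.trans (re_le_norm _))
  gcongr

lemma norm_div_sq_add_sq_le {r : ℝ} (hr : 0 < r) {w : ℂ} (hw : r ≤ w.re) (s : ℝ) :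
    ‖w / (w ^ 2 + (s : ℂ) ^ 2)‖ ≤ 1 / r := by
  have h1 : r ≤ ‖w + s * I‖ := hw.trans ((add_mul_I_re w s).ge.trans (re_le_norm _))
  have h2 : r ≤ ‖w - s * I‖ := hw.trans ((sub_mul_I_re w s).ge.trans (re_le_norm _))
  have hp := hr.trans_le hw
  have e : w / (w ^ 2 + (s : ℂ) ^ 2) = (1 / 2) * ((w + s * I)⁻¹ + (w - s * I)⁻¹) := by
    rw [inv_add_mul_I_add_inv hp]
    ring
  have i1 : ‖(w + s * I)⁻¹‖ ≤ 1 / r := by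
    rw [norm_inv, ← one_div]; gcongr
  have i2 : ‖(w - s * I)⁻¹‖ ≤ 1 / r := by
    rw [norm_inv, ← one_div]; gcongr
  rw [e, norm_mul]
  have := norm_add_le (w + s * I)⁻¹ (w - s * I)⁻¹
  norm_num
  norm_num at i1 i2 this
  linarith

/-- A closed form, for `0 < re w`, of `arctan (s / w) = ∫ u in 0..s, w / (w ^ 2 + u ^ 2)`. -/
noncomputable def arctanLog (w : ℂ) (s : ℝ) : ℂ :=
  (1 / (2 * I)) * (log (w + s * I) - log (w - s * I))

lemma integral_div_sq_add_sq_eq_arctanLog {w : ℂ} (hw : 0 < w.re) (s : ℝ) :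
    ∫ u in (0 : ℝ)..s, w / (w ^ 2 + (u : ℂ) ^ 2) = arctanLog w s := by
  have hd : ∀ u : ℝ, HasDerivAt (fun u : ℝ => arctanLog w u) (w / (w ^ 2 + (u : ℂ) ^ 2)) u := by
    intro u
    have hu : HasDerivAt (fun u : ℝ => (u : ℂ) * I) I u := by
      simpa using (ofRealCLM.hasDerivAt (x := u)).mul_const I
    have h1 := (hu.const_add w).clog_real (Or.inl (by simpa using hw))
    have h2 := (hu.const_sub w).clog_real (Or.inl (by simpa using hw))
    refine ((h1.sub h2).const_mul (1 / (2 * I))).congr_deriv ?_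
    have e := inv_add_mul_I_add_inv hw u
    have : (2 : ℂ) * I ≠ 0 := mul_ne_zero two_ne_zero I_ne_zero
    rw [one_div_mul_eq_div, div_eq_iff this]
    linear_combination I * e
  rw [intervalIntegral.integral_eq_sub_of_hasDerivAt (fun u _ => hd u)]
  · simp [arctanLog]
  · apply Continuous.intervalIntegrable
    exact continuous_const.div (by fun_prop) (sq_add_sq_ne_zero hw)

lemma hasDerivAt_arctanLog {w : ℂ} (hw : 0 < w.re) (s : ℝ) :
    HasDerivAt (fun w => arctanLog w s) (-(s / (w ^ 2 + (s : ℂ) ^ 2))) w := by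
  have h1 := ((hasDerivAt_id w).add_const ((s : ℂ) * I)).clog (Or.inl (by simpa using hw))
  have h2 := ((hasDerivAt_id w).sub_const ((s : ℂ) * I)).clog (Or.inl (by simpa using hw))
  refine ((h1.sub h2).const_mul (1 / (2 * I))).congr_deriv ?_
  have e := inv_add_mul_I_sub_inv hw s
  have : (2 : ℂ) * I ≠ 0 := mul_ne_zero two_ne_zero I_ne_zero
  rw [one_div_mul_eq_div, div_eq_iff this]
  simp only [id]
  linear_combination e

lemma norm_arctanLog_le {w : ℂ} (hw : 0 < w.re) {s : ℝ} (hs : 0 ≤ s) :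
    ‖arctanLog w s‖ ≤ s / w.re := by
  rw [← integral_div_sq_add_sq_eq_arctanLog hw]
  refine (intervalIntegral.norm_integral_le_of_norm_le_const
    (fun u _ => norm_div_sq_add_sq_le hw le_rfl u)).trans_eq ?_
  rw [sub_zero, abs_of_nonneg hs]
  ring

lemma measurable_arctanLog (w : ℂ) : Measurable (arctanLog w) := by
  unfold arctanLog
  fun_prop

lemma norm_log_le {z : ℂ} (hz : z ≠ 0) : ‖log z‖ ≤ ‖z‖ + ‖z‖⁻¹ + Real.pi := by
  have hp := norm_pos_iff.2 hz
  refine (norm_le_abs_re_add_abs_im _).trans (add_le_add ?_ ((log_im z).symm ▸ abs_arg_le_pi z))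
  rw [log_re, abs_le]
  have h1 := Real.log_le_sub_one_of_pos hp
  have h2 := Real.one_sub_inv_le_log_of_pos hp
  have h3 := inv_pos.2 hp
  constructor <;> linarith

lemma norm_log_sq_add_sq_le {w : ℂ} (hw : 0 < w.re) (s : ℝ) :
    ‖log ((s : ℂ) ^ 2 + w ^ 2)‖ ≤ s ^ 2 + (‖w‖ ^ 2 + (w.re ^ 2)⁻¹ + Real.pi) := by
  refine (norm_log_le (slitPlane_ne_zero (sq_add_sq_mem_slitPlane hw s))).trans ?_
  have h1 : ‖(s : ℂ) ^ 2 + w ^ 2‖ ≤ s ^ 2 + ‖w‖ ^ 2 := by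
    refine (norm_add_le _ _).trans_eq ?_
    simp
  have h2 : ‖(s : ℂ) ^ 2 + w ^ 2‖⁻¹ ≤ (w.re ^ 2)⁻¹ := by
    rw [add_comm]
    have := sq_le_norm_sq_add_sq hw le_rfl s
    gcongr
  linarith

lemma integrableOn_pow_mul_exp_neg_mul {b : ℝ} (hb : 0 < b) (n : ℕ) :
    IntegrableOn (fun s : ℝ => s ^ n * Real.exp (-b * s)) (Ioi 0) := by
  have := integrableOn_rpow_mul_exp_neg_mul_rpow (p := 1) (s := n) (b := b)
    (by have : (0 : ℝ) ≤ n := n.cast_nonneg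
        linarith) one_pos hb
  simpa using this

lemma integral_exp_hasDerivAt {b : ℝ} (hb : 0 < b) {w₀ : ℂ} (hw₀ : 0 < w₀.re)
    {f f' : ℂ → ℝ → ℂ} {C c : ℝ} (hf : ∀ w, Measurable (f w)) (hf' : Measurable (f' w₀))
    (hbound : ∀ s, 0 < s → ‖f w₀ s‖ ≤ s ^ 3 + C * s)
    (hbound' : ∀ s, 0 < s → ∀ w, w₀.re / 2 < w.re → ‖f' w s‖ ≤ c * s)
    (hderiv : ∀ s, 0 < s → ∀ w, 0 < w.re → HasDerivAt (fun w => f w s) (f' w s) w) :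
    HasDerivAt (fun w => ∫ s in Ioi (0 : ℝ), f w s * (Real.exp (-b * s) : ℂ))
      (∫ s in Ioi (0 : ℝ), f' w₀ s * (Real.exp (-b * s) : ℂ)) w₀ := by
  have hU : {w : ℂ | w₀.re / 2 < w.re} ∈ 𝓝 w₀ :=
    (isOpen_lt continuous_const continuous_re).mem_nhds (by simpa using hw₀)
  have hnorm : ∀ s : ℝ, ‖(Real.exp (-b * s) : ℂ)‖ = Real.exp (-b * s) := fun s => by
    rw [norm_real, Real.norm_of_nonneg (Real.exp_pos _).le]
  have hi1 := integrableOn_pow_mul_exp_neg_mul hb 1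
  have hi3 := integrableOn_pow_mul_exp_neg_mul hb 3
  have hexp : Measurable fun s : ℝ => (Real.exp (-b * s) : ℂ) := by fun_prop
  refine (hasDerivAt_integral_of_dominated_loc_of_deriv_le
    (bound := fun s => c * (s ^ 1 * Real.exp (-b * s)))
    (F' := fun w s => f' w s * (Real.exp (-b * s) : ℂ)) hU
    (Eventually.of_forall fun w => ((hf w).mul hexp).aestronglyMeasurable) ?_
    (hf'.mul hexp).aestronglyMeasurable ?_ (hi1.const_mul c) ?_).2
  · refine (hi3.add (hi1.const_mul C)).mono' ((hf w₀).mul hexp).aestronglyMeasurable ?_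
    refine (ae_restrict_iff' measurableSet_Ioi).2 (Eventually.of_forall fun s hs => ?_)
    simp only [Pi.mul_apply, Pi.add_apply]
    rw [norm_mul, hnorm]
    refine (mul_le_mul_of_nonneg_right (hbound s hs) (Real.exp_pos _).le).trans_eq ?_
    ring
  · refine (ae_restrict_iff' measurableSet_Ioi).2 (Eventually.of_forall fun s hs w hw => ?_)
    rw [norm_mul, hnorm]
    refine (mul_le_mul_of_nonneg_right (hbound' s hs w hw) (Real.exp_pos _).le).trans_eq ?_
    ring
  · refine (ae_restrict_iff' measurableSet_Ioi).2 (Eventually.of_forall fun s hs w hw => ?_)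
    have : w₀.re / 2 < w.re := hw
    exact (hderiv s hs w (by linarith)).mul_const _

lemma hasDerivAt_integral_arctan {b : ℝ} (hb : 0 < b) {w₀ : ℂ} (hw₀ : 0 < w₀.re) :
    HasDerivAt (fun w : ℂ => ∫ s in Ioi (0 : ℝ),
        (∫ u in (0 : ℝ)..s, w / (w ^ 2 + (u : ℂ) ^ 2)) * (Real.exp (-b * s) : ℂ))
      (∫ s in Ioi (0 : ℝ), -(s / (w₀ ^ 2 + (s : ℂ) ^ 2)) * (Real.exp (-b * s) : ℂ)) w₀ := by
  have hr : 0 < w₀.re / 2 := by linarith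
  have key := integral_exp_hasDerivAt hb hw₀ (f := arctanLog)
    (f' := fun w s => -(s / (w ^ 2 + (s : ℂ) ^ 2))) (C := 1 / w₀.re) (c := 1 / (w₀.re / 2) ^ 2)
    measurable_arctanLog (by fun_prop) (fun s hs => ?_) (fun s hs w hw => ?_)
    (fun s _ w hw => hasDerivAt_arctanLog hw s)
  · refine key.congr_of_eventuallyEq ?_
    filter_upwards [(isOpen_lt continuous_const continuous_re).mem_nhds hw₀] with w hw
    simp only [integral_div_sq_add_sq_eq_arctanLog hw]
  · have h3 : 0 < s ^ 3 := by positivity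
    have := norm_arctanLog_le hw₀ hs.le
    rw [one_div_mul_eq_div]
    linarith
  · rw [norm_neg, norm_div, norm_real, Real.norm_of_nonneg hs.le, one_div_mul_eq_div]
    have := sq_le_norm_sq_add_sq hr hw.le s
    gcongr

lemma hasDerivAt_integral_log {b : ℝ} (hb : 0 < b) {w₀ : ℂ} (hw₀ : 0 < w₀.re) :
    HasDerivAt (fun w : ℂ => ∫ s in Ioi (0 : ℝ),
        (s : ℂ) * log ((s : ℂ) ^ 2 + w ^ 2) * (Real.exp (-b * s) : ℂ))
      (∫ s in Ioi (0 : ℝ), (s : ℂ) * (2 * (w₀ / (w₀ ^ 2 + (s : ℂ) ^ 2)))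
        * (Real.exp (-b * s) : ℂ)) w₀ := by
  have hr : 0 < w₀.re / 2 := by linarith
  refine integral_exp_hasDerivAt hb hw₀ (f := fun w s => (s : ℂ) * log ((s : ℂ) ^ 2 + w ^ 2))
    (f' := fun w s => (s : ℂ) * (2 * (w / (w ^ 2 + (s : ℂ) ^ 2))))
    (C := ‖w₀‖ ^ 2 + (w₀.re ^ 2)⁻¹ + Real.pi) (c := 2 * (1 / (w₀.re / 2)))
    (fun w => by fun_prop) (by fun_prop) (fun s hs => ?_) (fun s hs w hw => ?_)
    (fun s _ w hw => ?_)
  · rw [norm_mul, norm_real, Real.norm_of_nonneg hs.le]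
    refine (mul_le_mul_of_nonneg_left (norm_log_sq_add_sq_le hw₀ s) hs.le).trans_eq ?_
    ring
  · rw [norm_mul, norm_mul, norm_real, Real.norm_of_nonneg hs.le, norm_ofNat, mul_comm s]
    have := norm_div_sq_add_sq_le hr hw.le s
    gcongr
  · have h := (((hasDerivAt_id w).pow 2).const_add ((s : ℂ) ^ 2)).clog
      (sq_add_sq_mem_slitPlane hw s)
    refine (h.const_mul (s : ℂ)).congr_deriv ?_
    simp only [Pi.pow_apply, id]
    rw [add_comm (w ^ 2)]
    push_cast
    ring

end Oscillator

/-- The tau-function property of a simple oscillator: on `{Re(Z/t) > 0}` the complex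
partial derivatives exist and `∂F/∂t = ∂G/∂Z`. -/
theorem oscillator_tau_function (m : ℕ) (hm : 1 ≤ m) :
    ∀ t Z : ℂ, t ≠ 0 → 0 < (Z / t).re →
      ∃ d : ℂ,
        HasDerivAt (fun t' : ℂ => oscF m t' Z) d t ∧
        HasDerivAt (fun Z' : ℂ => oscG m t Z') d Z := by
  intro t Z ht hw
  have hb : (0 : ℝ) < m := by exact_mod_cast hm
  have hF := (Oscillator.hasDerivAt_integral_arctan hb hw).comp t ((hasDerivAt_inv ht).const_mul Z)
  have hG := ((Oscillator.hasDerivAt_integral_log hb hw).comp Z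
    ((hasDerivAt_id Z).div_const t)).const_mul (1 / 2 : ℂ)
  refine ⟨_, hF, hG.congr_deriv ?_⟩
  rw [← integral_mul_const, ← integral_mul_const, ← integral_const_mul]
  refine integral_congr_ae (Filter.Eventually.of_forall fun s => ?_)
  simp only
  field_simp
end
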